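/- Saturation lemma: if a finite tree sequent Γ ⇒^T Δ is unprovable in TEFL⁻, then there exists a saturated, possibly infinite tree sequent Γ⁺ ⇒^{T⁺} Δ⁺ that is still unprovable in TEFL⁻ and extends the original one, i.e., Γ ⊆ Γ⁺, Δ ⊆ Δ⁺ and T ⊆ T⁺. -/

import Mathlib

set_option autoImplicit false

/-- Formulas of Epistemic Logic of Friendship:
    nominals, propositional variables, ⊥, →, @ₙ, F, □. -/
inductive Form : Type
  | nom : ℕ → Form
  | pv  : ℕ → Form
  | bot : Form
  | imp : Form → Form → Form
  | atf : ℕ → Form → Form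
  | fr  : Form → Form
  | box : Form → Form
  deriving DecidableEq

def Form.neg (φ : Form) : Form := Form.imp φ Form.bot
def Form.top : Form := Form.neg Form.bot
def Form.and (φ ψ : Form) : Form := Form.neg (Form.imp φ (Form.neg ψ))
def Form.or (φ ψ : Form) : Form := Form.imp (Form.neg φ) ψ
def Form.iff (φ ψ : Form) : Form := Form.and (Form.imp φ ψ) (Form.imp ψ φ)
/-- ⟨F⟩φ := ¬F¬φ -/
def Form.diaF (φ : Form) : Form := Form.neg (Form.fr (Form.neg φ))

/-- `Form.sub m k φ` is φ[m/k] : substitute nominal k by nominal m. -/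
def Form.sub (m k : ℕ) : Form → Form
  | .nom n => if n = k then .nom m else .nom n
  | .pv p => .pv p
  | .bot => .bot
  | .imp φ ψ => .imp (Form.sub m k φ) (Form.sub m k ψ)
  | .atf n φ => .atf (if n = k then m else n) (Form.sub m k φ)
  | .fr φ => .fr (Form.sub m k φ)
  | .box φ => .box (Form.sub m k φ)

/-- nominals occurring in a formula -/
def Form.noms : Form → Finset ℕ
  | .nom n => {n}
  | .pv _ => ∅
  | .bot => ∅
  | .imp φ ψ => Form.noms φ ∪ Form.noms ψ
  | .atf n φ => insert n (Form.noms φ)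
  | .fr φ => Form.noms φ
  | .box φ => Form.noms φ

/-- Labels: natural numbers are labels, and `child α n i` is the label α·ₙi,
    an n-child of α. -/
inductive Label : Type
  | root : ℕ → Label
  | child : Label → ℕ → ℕ → Label
  deriving DecidableEq

/-- nominals occurring in a label -/
def Label.noms : Label → Finset ℕ
  | .root _ => ∅
  | .child α n _ => insert n (Label.noms α)

/-- natural numbers occurring in a label -/
def Label.nats : Label → Finset ℕ
  | .root j => {j}
  | .child α _ i => insert i (Label.nats α)

/-- apply a nominal renaming to (the edge nominals of) a label -/
def Label.subst (σn : ℕ → ℕ) : Label → Label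
  | .root j => .root j
  | .child α n i => .child (Label.subst σn α) (σn n) i

/-- A labelled formula (α, φ) stands for α:φ, where φ is intended @-prefixed. -/
abbrev LForm : Type := Label × Form

/-- A finite tree of labels: a unique natural-number root, closed under parents. -/
def IsTree (T : Finset Label) : Prop :=
  (∃! j : ℕ, Label.root j ∈ T) ∧ ∀ α n i, Label.child α n i ∈ T → α ∈ T

/-- A (possibly infinite) tree of labels. -/
def SetIsTree (T : Set Label) : Prop :=
  (∃! j : ℕ, Label.root j ∈ T) ∧ ∀ α n i, Label.child α n i ∈ T → α ∈ T

/-- A frame: states, agents, accessibility Rₐ and friendship ≍_w. -/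
structure Frame (W A : Type) : Type where
  wne : Nonempty W
  ane : Nonempty A
  R : A → W → W → Prop
  friend : W → A → A → Prop

/-- A model: a frame with a valuation; nominals denote unique agents via `Vn`
    (this builds in V(n) = W × {n̲}). -/
structure Model (W A : Type) extends Frame W A where
  Vp : ℕ → W → A → Prop
  Vn : ℕ → A

section Semantics
variable {W A : Type}

/-- Two-dimensional satisfaction M,(w,a) ⊨ φ. -/
def Sat (M : Model W A) : W → A → Form → Prop
  | _, a, .nom n => M.Vn n = a
  | w, a, .pv p => M.Vp p w a
  | _, _, .bot => False
  | w, a, .imp φ ψ => Sat M w a φ → Sat M w a ψ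
  | w, _, .atf n φ => Sat M w (M.Vn n) φ
  | w, a, .fr φ => ∀ b, M.friend w a b → Sat M w b φ
  | w, a, .box φ => ∀ v, M.R a w v → Sat M v a φ

/-- f is a T-assignment: it respects the n-child edges of T. -/
def IsAssign (M : Model W A) (T : Finset Label) (f : Label → W) : Prop :=
  ∀ α n i, Label.child α n i ∈ T → M.R (M.Vn n) (f α) (f (Label.child α n i))

/-- Truth of a labelled formula α:@ₙφ at (M,f); for @-prefixed formulas
    the agent coordinate is irrelevant. -/
def LSat (M : Model W A) (f : Label → W) (l : LForm) : Prop :=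
  ∀ a : A, Sat M (f l.1) a l.2

/-- Truth of a tree sequent Γ ⇒ᵀ Δ at (M,f). -/
def SeqTrue (M : Model W A) (f : Label → W) (Γ Δ : Finset LForm) : Prop :=
  (∀ l ∈ Γ, LSat M f l) → ∃ l ∈ Δ, LSat M f l

end Semantics

/-- Nominal m is fresh in the sequent Γ ⇒ᵀ Δ. -/
def FreshNom (m : ℕ) (T : Finset Label) (Γ Δ : Finset LForm) : Prop :=
  (∀ β ∈ T, m ∉ Label.noms β) ∧
    (∀ l ∈ Γ, m ∉ Label.noms l.1 ∧ m ∉ Form.noms l.2) ∧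
    (∀ l ∈ Δ, m ∉ Label.noms l.1 ∧ m ∉ Form.noms l.2)

/-- Natural number i is fresh in the sequent Γ ⇒ᵀ Δ. -/
def FreshNat (i : ℕ) (T : Finset Label) (Γ Δ : Finset LForm) : Prop :=
  (∀ β ∈ T, i ∉ Label.nats β) ∧
    (∀ l ∈ Γ, i ∉ Label.nats l.1) ∧ (∀ l ∈ Δ, i ∉ Label.nats l.1)

/-- Tree-sequent derivations of height ≤ h.  `Deriv true` is TEFL (with Cut),
    `Deriv false` is TEFL⁻ (without Cut). -/
inductive Deriv (c : Bool) : Finset Label → Finset LForm → Finset LForm → ℕ → Prop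
  | bot {T : Finset Label} {Γ Δ : Finset LForm} (α : Label) (n : ℕ) :
      Deriv c T (insert (α, Form.atf n Form.bot) Γ) Δ 0
  | id {T : Finset Label} {Γ Δ : Finset LForm} (α : Label) (n : ℕ) (φ : Form) :
      Deriv c T (insert (α, Form.atf n φ) Γ) (insert (α, Form.atf n φ) Δ) 0
  | rep1 {T : Finset Label} {Γ Δ : Finset LForm} {h : ℕ} (α : Label) (n m k : ℕ) (φ : Form) :
      Deriv c T (insert (α, Form.atf n (Form.nom m)) (insert (α, Form.sub n k φ) Γ)) Δ h →
      Deriv c T (insert (α, Form.atf n (Form.nom m)) (insert (α, Form.sub m k φ) Γ)) Δ (h+1)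
  | rep2 {T : Finset Label} {Γ Δ : Finset LForm} {h : ℕ} (α : Label) (n m k : ℕ) (φ : Form) :
      Deriv c T (insert (α, Form.atf n (Form.nom m)) (insert (α, Form.sub m k φ) Γ)) Δ h →
      Deriv c T (insert (α, Form.atf n (Form.nom m)) (insert (α, Form.sub n k φ) Γ)) Δ (h+1)
  | refl {T : Finset Label} {Γ Δ : Finset LForm} {h : ℕ} (α : Label) (n : ℕ) :
      α ∈ T →
      Deriv c T (insert (α, Form.atf n (Form.nom n)) Γ) Δ h →
      Deriv c T Γ Δ (h+1)
  | rigid {T : Finset Label} {Γ Δ : Finset LForm} {h : ℕ} (α β : Label) (n m : ℕ) :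
      β ∈ T →
      Deriv c T (insert (β, Form.atf n (Form.nom m)) Γ) Δ h →
      Deriv c T (insert (α, Form.atf n (Form.nom m)) Γ) Δ (h+1)
  | impR {T : Finset Label} {Γ Δ : Finset LForm} {h : ℕ} (α : Label) (n : ℕ) (φ ψ : Form) :
      Deriv c T (insert (α, Form.atf n φ) Γ) (insert (α, Form.atf n ψ) Δ) h →
      Deriv c T Γ (insert (α, Form.atf n (Form.imp φ ψ)) Δ) (h+1)
  | impL {T : Finset Label} {Γ Δ : Finset LForm} {h₁ h₂ : ℕ} (α : Label) (n : ℕ) (φ ψ : Form) :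
      Deriv c T Γ (insert (α, Form.atf n φ) Δ) h₁ →
      Deriv c T (insert (α, Form.atf n ψ) Γ) Δ h₂ →
      Deriv c T (insert (α, Form.atf n (Form.imp φ ψ)) Γ) Δ (max h₁ h₂ + 1)
  | atR {T : Finset Label} {Γ Δ : Finset LForm} {h : ℕ} (α : Label) (n m : ℕ) (φ : Form) :
      Deriv c T Γ (insert (α, Form.atf m φ) Δ) h →
      Deriv c T Γ (insert (α, Form.atf n (Form.atf m φ)) Δ) (h+1)
  | atL {T : Finset Label} {Γ Δ : Finset LForm} {h : ℕ} (α : Label) (n m : ℕ) (φ : Form) :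
      Deriv c T (insert (α, Form.atf m φ) Γ) Δ h →
      Deriv c T (insert (α, Form.atf n (Form.atf m φ)) Γ) Δ (h+1)
  | frR {T : Finset Label} {Γ Δ : Finset LForm} {h : ℕ} (α : Label) (n m : ℕ) (φ : Form) :
      FreshNom m T Γ (insert (α, Form.atf n (Form.fr φ)) Δ) →
      Deriv c T (insert (α, Form.atf n (Form.diaF (Form.nom m))) Γ)
        (insert (α, Form.atf m φ) Δ) h →
      Deriv c T Γ (insert (α, Form.atf n (Form.fr φ)) Δ) (h+1)
  | frL {T : Finset Label} {Γ Δ : Finset LForm} {h₁ h₂ : ℕ} (α : Label) (n m : ℕ) (φ : Form) :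
      Deriv c T Γ (insert (α, Form.atf n (Form.diaF (Form.nom m))) Δ) h₁ →
      Deriv c T (insert (α, Form.atf m φ) Γ) Δ h₂ →
      Deriv c T (insert (α, Form.atf n (Form.fr φ)) Γ) Δ (max h₁ h₂ + 1)
  | boxR {T : Finset Label} {Γ Δ : Finset LForm} {h : ℕ} (α : Label) (n i : ℕ) (φ : Form) :
      FreshNat i T Γ (insert (α, Form.atf n (Form.box φ)) Δ) →
      Deriv c (insert (Label.child α n i) T) Γ
        (insert (Label.child α n i, Form.atf n φ) Δ) h →
      Deriv c T Γ (insert (α, Form.atf n (Form.box φ)) Δ) (h+1)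
  | boxL {T : Finset Label} {Γ Δ : Finset LForm} {h : ℕ} (α : Label) (n i : ℕ) (φ : Form) :
      Label.child α n i ∈ T →
      Deriv c T (insert (Label.child α n i, Form.atf n φ) Γ) Δ h →
      Deriv c T (insert (α, Form.atf n (Form.box φ)) Γ) Δ (h+1)
  | wlab {T : Finset Label} {Γ Δ : Finset LForm} {h : ℕ} (α : Label) :
      IsTree (insert α T) →
      Deriv c T Γ Δ h →
      Deriv c (insert α T) Γ Δ (h+1)
  | cut {T : Finset Label} {Γ Δ P S : Finset LForm} {h₁ h₂ : ℕ} (α : Label) (n : ℕ) (φ : Form) :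
      c = true → α ∈ T →
      Deriv c T Γ (insert (α, Form.atf n φ) Δ) h₁ →
      Deriv c T (insert (α, Form.atf n φ) P) S h₂ →
      Deriv c T (Γ ∪ P) (Δ ∪ S) (max h₁ h₂ + 1)

/-- Provability of a finite tree sequent (`true` = TEFL, `false` = TEFL⁻). -/
def Provable (c : Bool) (T : Finset Label) (Γ Δ : Finset LForm) : Prop :=
  ∃ h : ℕ, Deriv c T Γ Δ h

/-- Provability of a possibly infinite tree sequent in TEFL⁻ :
    some finite subsequent over a finite subtree is provable. -/
def InfProvable (T : Set Label) (Γ Δ : Set LForm) : Prop :=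
  ∃ (T' : Finset Label) (Γ' Δ' : Finset LForm),
    ↑T' ⊆ T ∧ IsTree T' ∧ ↑Γ' ⊆ Γ ∧ ↑Δ' ⊆ Δ ∧ Provable false T' Γ' Δ'

/-- Saturation conditions for a possibly infinite tree sequent. -/
structure Saturated (T : Set Label) (Γ Δ : Set LForm) : Prop where
  rep1 : ∀ (α : Label) (n m k : ℕ) (φ : Form),
    (α, Form.atf n (Form.nom m)) ∈ Γ → (α, Form.sub n k φ) ∈ Γ → (α, Form.sub m k φ) ∈ Γ
  rep2 : ∀ (α : Label) (n m k : ℕ) (φ : Form),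
    (α, Form.atf m (Form.nom n)) ∈ Γ → (α, Form.sub n k φ) ∈ Γ → (α, Form.sub m k φ) ∈ Γ
  refl : ∀ α ∈ T, ∀ n : ℕ, (α, Form.atf n (Form.nom n)) ∈ Γ
  rigid : ∀ (α β : Label) (n m : ℕ), β ∈ T →
    (α, Form.atf n (Form.nom m)) ∈ Γ → (β, Form.atf n (Form.nom m)) ∈ Γ
  impR : ∀ (α : Label) (n : ℕ) (φ ψ : Form), (α, Form.atf n (Form.imp φ ψ)) ∈ Δ →
    (α, Form.atf n φ) ∈ Γ ∧ (α, Form.atf n ψ) ∈ Δ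
  impL : ∀ (α : Label) (n : ℕ) (φ ψ : Form), (α, Form.atf n (Form.imp φ ψ)) ∈ Γ →
    (α, Form.atf n φ) ∈ Δ ∨ (α, Form.atf n ψ) ∈ Γ
  atR : ∀ (α : Label) (n m : ℕ) (φ : Form), (α, Form.atf n (Form.atf m φ)) ∈ Δ →
    (α, Form.atf m φ) ∈ Δ
  atL : ∀ (α : Label) (n m : ℕ) (φ : Form), (α, Form.atf n (Form.atf m φ)) ∈ Γ →
    (α, Form.atf m φ) ∈ Γ
  frR : ∀ (α : Label) (n : ℕ) (φ : Form), (α, Form.atf n (Form.fr φ)) ∈ Δ →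
    ∃ m : ℕ, (α, Form.atf n (Form.diaF (Form.nom m))) ∈ Γ ∧ (α, Form.atf m φ) ∈ Δ
  frL : ∀ (α : Label) (n : ℕ) (φ : Form), (α, Form.atf n (Form.fr φ)) ∈ Γ →
    ∀ m : ℕ, (α, Form.atf n (Form.diaF (Form.nom m))) ∈ Δ ∨ (α, Form.atf m φ) ∈ Γ
  boxR : ∀ (α : Label) (n : ℕ) (φ : Form), (α, Form.atf n (Form.box φ)) ∈ Δ →
    ∃ i : ℕ, Label.child α n i ∈ T ∧ (Label.child α n i, Form.atf n φ) ∈ Δ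
  boxL : ∀ (α : Label) (n : ℕ) (φ : Form), (α, Form.atf n (Form.box φ)) ∈ Γ →
    ∀ i : ℕ, Label.child α n i ∈ T → (Label.child α n i, Form.atf n φ) ∈ Γ

/-- n ~ m iff α:@ₙm ∈ Γ for some α ∈ T. -/
def nrel (T : Set Label) (Γ : Set LForm) (n m : ℕ) : Prop :=
  ∃ α ∈ T, (α, Form.atf n (Form.nom m)) ∈ Γ

/-- Propositional tautology (instance): true under every boolean valuation
    respecting ⊥ and →. -/
def IsTaut (φ : Form) : Prop :=
  ∀ v : Form → Bool, v Form.bot = false →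
    (∀ ψ χ : Form, v (Form.imp ψ χ) = (!(v ψ) || v χ)) → v φ = true

/-- Uniform substitution: propositional variables by formulas, nominals by nominals. -/
def ApplySub (σp : ℕ → Form) (σn : ℕ → ℕ) : Form → Form
  | .nom n => .nom (σn n)
  | .pv p => σp p
  | .bot => .bot
  | .imp φ ψ => .imp (ApplySub σp σn φ) (ApplySub σp σn ψ)
  | .atf n φ => .atf (σn n) (ApplySub σp σn φ)
  | .fr φ => .fr (ApplySub σp σn φ)
  | .box φ => .box (ApplySub σp σn φ)

/-- Necessity forms L ::= # | ψ→L | @ₙ□L. -/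
inductive NForm : Type
  | hole : NForm
  | imp : Form → NForm → NForm
  | atBox : ℕ → NForm → NForm

/-- L(χ): replace the unique occurrence of # in L by χ. -/
def NForm.fill : NForm → Form → Form
  | .hole, χ => χ
  | .imp ψ L, χ => Form.imp ψ (NForm.fill L χ)
  | .atBox n L, χ => Form.atf n (Form.box (NForm.fill L χ))

/-- The Hilbert system HEFL, extended by an extra set `ax` of axioms
    (HEFL itself is `Hil ∅`). -/
inductive Hil (ax : Set Form) : Form → Prop
  | extra {φ : Form} : φ ∈ ax → Hil ax φ
  | taut {φ : Form} : IsTaut φ → Hil ax φ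
  | kBox (p q : ℕ) : Hil ax (Form.imp (Form.box (Form.imp (Form.pv p) (Form.pv q)))
      (Form.imp (Form.box (Form.pv p)) (Form.box (Form.pv q))))
  | kF (p q : ℕ) : Hil ax (Form.imp (Form.fr (Form.imp (Form.pv p) (Form.pv q)))
      (Form.imp (Form.fr (Form.pv p)) (Form.fr (Form.pv q))))
  | kAt (n p q : ℕ) : Hil ax (Form.imp (Form.atf n (Form.imp (Form.pv p) (Form.pv q)))
      (Form.imp (Form.atf n (Form.pv p)) (Form.atf n (Form.pv q))))
  | refAx (n : ℕ) : Hil ax (Form.atf n (Form.nom n))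
  | selfdual (n p : ℕ) : Hil ax (Form.iff (Form.neg (Form.atf n (Form.pv p)))
      (Form.atf n (Form.neg (Form.pv p))))
  | elim (n p : ℕ) : Hil ax (Form.imp (Form.atf n (Form.pv p))
      (Form.imp (Form.nom n) (Form.pv p)))
  | agree (n m p : ℕ) : Hil ax (Form.imp (Form.atf n (Form.atf m (Form.pv p)))
      (Form.atf m (Form.pv p)))
  | back (n p : ℕ) : Hil ax (Form.imp (Form.atf n (Form.pv p))
      (Form.fr (Form.atf n (Form.pv p))))
  | dcom (n p : ℕ) : Hil ax (Form.iff (Form.atf n (Form.box (Form.atf n (Form.pv p))))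
      (Form.atf n (Form.box (Form.pv p))))
  | rigidEq (n m : ℕ) : Hil ax (Form.imp (Form.atf n (Form.nom m))
      (Form.box (Form.atf n (Form.nom m))))
  | rigidNeq (n m : ℕ) : Hil ax (Form.imp (Form.neg (Form.atf n (Form.nom m)))
      (Form.box (Form.neg (Form.atf n (Form.nom m)))))
  | mp {φ ψ : Form} : Hil ax (Form.imp φ ψ) → Hil ax φ → Hil ax ψ
  | necBox {φ : Form} : Hil ax φ → Hil ax (Form.box φ)
  | necF {φ : Form} : Hil ax φ → Hil ax (Form.fr φ)
  | necAt {φ : Form} (n : ℕ) : Hil ax φ → Hil ax (Form.atf n φ)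
  | us {φ : Form} (σp : ℕ → Form) (σn : ℕ → ℕ) : Hil ax φ → Hil ax (ApplySub σp σn φ)
  | name {φ : Form} (n : ℕ) : n ∉ Form.noms φ →
      Hil ax (Form.imp (Form.nom n) φ) → Hil ax φ
  | lbg {φ : Form} (L : NForm) (n m : ℕ) :
      m ∉ Form.noms (NForm.fill L (Form.atf n (Form.fr φ))) →
      Hil ax (NForm.fill L (Form.imp (Form.atf n (Form.diaF (Form.nom m))) (Form.atf m φ))) →
      Hil ax (NForm.fill L (Form.atf n (Form.fr φ)))

/-- finite conjunction (empty = ⊤) -/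
def conjList : List Form → Form
  | [] => Form.top
  | φ :: l => Form.and φ (conjList l)

/-- finite disjunction (empty = ⊥) -/
def disjList : List Form → Form
  | [] => Form.bot
  | φ :: l => Form.or φ (disjList l)

/-- Formulaic translation, with a fuel parameter bounding the recursion depth. -/
noncomputable def translAux : ℕ → Finset Label → Finset LForm → Finset LForm → Label → Form
  | 0, _, _, _, _ => Form.bot
  | d+1, T, Γ, Δ, α =>
    Form.imp (conjList ((Γ.filter (fun l => l.1 = α)).toList.map Prod.snd))
      (disjList (((Δ.filter (fun l => l.1 = α)).toList.map Prod.snd) ++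
        (T.toList.filterMap (fun β =>
          match β with
          | Label.child γ n i =>
            if γ = α then
              some (Form.atf n (Form.box (translAux d T Γ Δ (Label.child γ n i))))
            else none
          | Label.root _ => none))))

/-- ⟦Γ ⇒ᵀ Δ⟧_α : the formulaic translation of a tree sequent at label α. -/
noncomputable def transl (T : Finset Label) (Γ Δ : Finset LForm) (α : Label) : Form :=
  translAux (T.card + 1) T Γ Δ α

section FrameValidity
variable {W A : Type}

/-- A formula is valid in a frame: true under every valuation at every pair. -/
def FrameValid (F : Frame W A) (φ : Form) : Prop :=
  ∀ (Vp : ℕ → W → A → Prop) (Vn : ℕ → A) (w : W) (a : A),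
    Sat { toFrame := F, Vp := Vp, Vn := Vn } w a φ

end FrameValidity

/-- Formulas of the shape @ₙm or @ₙ⟨F⟩m. -/
def IsRho (φ : Form) : Prop :=
  (∃ n m : ℕ, φ = Form.atf n (Form.nom m)) ∨
    (∃ n m : ℕ, φ = Form.atf n (Form.diaF (Form.nom m)))

/-- Regular implications (ρ₁ ∧ … ∧ ρ_h) → (ρ₁' ∨ … ∨ ρ_l'). -/
def IsRegImp (φ : Form) : Prop :=
  ∃ l₁ l₂ : List Form, (∀ ρ ∈ l₁, IsRho ρ) ∧ (∀ ρ ∈ l₂, IsRho ρ) ∧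
    φ = Form.imp (conjList l₁) (disjList l₂)

/-- S4 := {□p→p, □p→□□p}. -/
def S4Ax : Set Form :=
  {Form.imp (Form.box (Form.pv 0)) (Form.pv 0),
   Form.imp (Form.box (Form.pv 0)) (Form.box (Form.box (Form.pv 0)))}

/-- S5 := S4 ∪ {p→□¬□¬p}. -/
def S5Ax : Set Form :=
  S4Ax ∪ {Form.imp (Form.pv 0)
    (Form.box (Form.neg (Form.box (Form.neg (Form.pv 0)))))}

open Filter Finset

theorem Form.applySub_congr {σ σ' : ℕ → ℕ} {φ : Form} (h : ∀ x ∈ φ.noms, σ x = σ' x) :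
    ApplySub Form.pv σ φ = ApplySub Form.pv σ' φ := by
  induction φ <;> simp_all [ApplySub, Form.noms]

theorem Form.applySub_id (φ : Form) : ApplySub Form.pv id φ = φ := by
  induction φ <;> simp_all [ApplySub]

/-- Renaming commutes with substitution, once the substituted nominal is renamed apart. -/
theorem Form.applySub_sub {σ : ℕ → ℕ} {n k k' : ℕ} {φ : Form} (h : k' ∉ φ.noms.image σ) :
    ApplySub Form.pv σ (Form.sub n k φ) =
      Form.sub (σ n) k' (ApplySub Form.pv (Function.update σ k k') φ) := by
  induction φ with
  | nom x =>
    by_cases hx : x = k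
    · simp [Form.sub, ApplySub, hx]
    · have : σ x ≠ k' := fun e => h (by simp [Form.noms, e])
      simp [Form.sub, ApplySub, hx, this]
  | atf x φ ih =>
    have ih' := ih fun e => h (by simp only [Form.noms, image_insert, mem_insert, e, or_true])
    by_cases hx : x = k
    · simp [Form.sub, ApplySub, hx, ih']
    · have : σ x ≠ k' := fun e => h (by simp [Form.noms, e])
      simp [Form.sub, ApplySub, hx, this, ih']
  | imp φ ψ ih₁ ih₂ =>
    simp only [Form.noms, image_union, mem_union, not_or] at h
    simp [Form.sub, ApplySub, ih₁ h.1, ih₂ h.2]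
  | pv | bot => rfl
  | fr φ ih | box φ ih => simp [Form.sub, ApplySub, ih h]

/-- Rename the nominals of a label by `σ` and its natural numbers by `τ`. -/
def Label.rename (σ τ : ℕ → ℕ) : Label → Label
  | .root j => .root (τ j)
  | .child α n i => .child (Label.rename σ τ α) (σ n) (τ i)

theorem Label.rename_congr {σ σ' τ τ' : ℕ → ℕ} {α : Label} (h : ∀ x ∈ α.noms, σ x = σ' x)
    (h' : ∀ i ∈ α.nats, τ i = τ' i) : α.rename σ τ = α.rename σ' τ' := by
  induction α <;> simp_all [Label.rename, Label.noms, Label.nats]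

theorem Label.rename_id (α : Label) : α.rename id id = α := by
  induction α <;> simp_all [Label.rename]

/-- Rename the nominals of a labelled formula by `σ` and its natural numbers by `τ`. -/
def LForm.rename (σ τ : ℕ → ℕ) (l : LForm) : LForm :=
  (l.1.rename σ τ, ApplySub Form.pv σ l.2)

theorem exists_freshNom (T : Finset Label) (Γ Δ : Finset LForm) : ∃ m, FreshNom m T Γ Δ := by
  obtain ⟨m, hm⟩ := Infinite.exists_notMem_finset
    (T.biUnion Label.noms ∪ (Γ ∪ Δ).biUnion fun l => l.1.noms ∪ l.2.noms)
  refine ⟨m, ?_⟩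
  simp only [mem_union, mem_biUnion, not_or, not_exists, not_and] at hm
  exact ⟨hm.1, fun l hl => hm.2 l (.inl hl), fun l hl => hm.2 l (.inr hl)⟩

theorem exists_freshNat (T : Finset Label) (Γ Δ : Finset LForm) : ∃ i, FreshNat i T Γ Δ := by
  obtain ⟨i, hi⟩ := Infinite.exists_notMem_finset
    (T.biUnion Label.nats ∪ (Γ ∪ Δ).biUnion fun l => l.1.nats)
  refine ⟨i, ?_⟩
  simp only [mem_union, mem_biUnion, not_or, not_exists, not_and] at hi
  exact ⟨hi.1, fun l hl => hi.2 l (.inl hl), fun l hl => hi.2 l (.inr hl)⟩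

/-! ### The rules with principal formulas kept in the premises -/

namespace Provable

variable {c : Bool} {T : Finset Label} {Γ Δ : Finset LForm} {α β : Label} {n m k i : ℕ}
  {φ ψ : Form}

theorem of_bot_mem (h : (α, Form.atf n Form.bot) ∈ Γ) : Provable c T Γ Δ := by
  rw [← insert_eq_of_mem h]
  exact ⟨_, .bot α n⟩

theorem of_mem_of_mem (h : (α, Form.atf n φ) ∈ Γ) (h' : (α, Form.atf n φ) ∈ Δ) :
    Provable c T Γ Δ := by
  rw [← insert_eq_of_mem h, ← insert_eq_of_mem h']
  exact ⟨_, .id α n φ⟩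

theorem rep1 (h : (α, Form.atf n (Form.nom m)) ∈ Γ) (h' : (α, Form.sub m k φ) ∈ Γ) :
    Provable c T (insert (α, Form.sub n k φ) Γ) Δ → Provable c T Γ Δ := by
  rintro ⟨_, d⟩
  rw [← insert_eq_of_mem (mem_insert_of_mem h)] at d
  have d' := Deriv.rep1 α n m k φ d
  rw [insert_eq_of_mem h', insert_eq_of_mem h] at d'
  exact ⟨_, d'⟩

theorem rep2 (h : (α, Form.atf n (Form.nom m)) ∈ Γ) (h' : (α, Form.sub n k φ) ∈ Γ) :
    Provable c T (insert (α, Form.sub m k φ) Γ) Δ → Provable c T Γ Δ := by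
  rintro ⟨_, d⟩
  rw [← insert_eq_of_mem (mem_insert_of_mem h)] at d
  have d' := Deriv.rep2 α n m k φ d
  rw [insert_eq_of_mem h', insert_eq_of_mem h] at d'
  exact ⟨_, d'⟩

theorem refl (h : α ∈ T) :
    Provable c T (insert (α, Form.atf n (Form.nom n)) Γ) Δ → Provable c T Γ Δ :=
  fun ⟨_, d⟩ => ⟨_, .refl α n h d⟩

theorem rigid (hβ : β ∈ T) (h : (α, Form.atf n (Form.nom m)) ∈ Γ) :
    Provable c T (insert (β, Form.atf n (Form.nom m)) Γ) Δ → Provable c T Γ Δ := by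
  rintro ⟨_, d⟩
  rw [← insert_eq_of_mem h]
  exact ⟨_, .rigid α β n m hβ d⟩

theorem impR (h : (α, Form.atf n (Form.imp φ ψ)) ∈ Δ) :
    Provable c T (insert (α, Form.atf n φ) Γ) (insert (α, Form.atf n ψ) Δ) →
      Provable c T Γ Δ := by
  rintro ⟨_, d⟩
  rw [← insert_eq_of_mem h]
  exact ⟨_, .impR α n φ ψ d⟩

theorem impL (h : (α, Form.atf n (Form.imp φ ψ)) ∈ Γ) :
    Provable c T Γ (insert (α, Form.atf n φ) Δ) →
      Provable c T (insert (α, Form.atf n ψ) Γ) Δ → Provable c T Γ Δ := by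
  rintro ⟨_, d₁⟩ ⟨_, d₂⟩
  rw [← insert_eq_of_mem h]
  exact ⟨_, .impL α n φ ψ d₁ d₂⟩

theorem atR (h : (α, Form.atf n (Form.atf m φ)) ∈ Δ) :
    Provable c T Γ (insert (α, Form.atf m φ) Δ) → Provable c T Γ Δ := by
  rintro ⟨_, d⟩
  rw [← insert_eq_of_mem h]
  exact ⟨_, .atR α n m φ d⟩

theorem atL (h : (α, Form.atf n (Form.atf m φ)) ∈ Γ) :
    Provable c T (insert (α, Form.atf m φ) Γ) Δ → Provable c T Γ Δ := by
  rintro ⟨_, d⟩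
  rw [← insert_eq_of_mem h]
  exact ⟨_, .atL α n m φ d⟩

theorem frR (h : (α, Form.atf n (Form.fr φ)) ∈ Δ) (hm : FreshNom m T Γ Δ) :
    Provable c T (insert (α, Form.atf n (Form.diaF (Form.nom m))) Γ)
      (insert (α, Form.atf m φ) Δ) → Provable c T Γ Δ := by
  rintro ⟨_, d⟩
  rw [← insert_eq_of_mem h]
  exact ⟨_, .frR α n m φ (by rwa [insert_eq_of_mem h]) d⟩

theorem frL (h : (α, Form.atf n (Form.fr φ)) ∈ Γ) :
    Provable c T Γ (insert (α, Form.atf n (Form.diaF (Form.nom m))) Δ) →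
      Provable c T (insert (α, Form.atf m φ) Γ) Δ → Provable c T Γ Δ := by
  rintro ⟨_, d₁⟩ ⟨_, d₂⟩
  rw [← insert_eq_of_mem h]
  exact ⟨_, .frL α n m φ d₁ d₂⟩

theorem boxR (h : (α, Form.atf n (Form.box φ)) ∈ Δ) (hi : FreshNat i T Γ Δ) :
    Provable c (insert (Label.child α n i) T) Γ (insert (Label.child α n i, Form.atf n φ) Δ) →
      Provable c T Γ Δ := by
  rintro ⟨_, d⟩
  rw [← insert_eq_of_mem h]
  exact ⟨_, .boxR α n i φ (by rwa [insert_eq_of_mem h]) d⟩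

theorem boxL (hi : Label.child α n i ∈ T) (h : (α, Form.atf n (Form.box φ)) ∈ Γ) :
    Provable c T (insert (Label.child α n i, Form.atf n φ) Γ) Δ → Provable c T Γ Δ := by
  rintro ⟨_, d⟩
  rw [← insert_eq_of_mem h]
  exact ⟨_, .boxL α n i φ hi d⟩

end Provable

/-! ### Renaming and weakening -/

theorem LForm.rename_mem_insert {σ τ : ℕ → ℕ} {Θ Θ' : Finset LForm}
    (h : ∀ l ∈ Θ, LForm.rename σ τ l ∈ Θ') (l : LForm) :
    ∀ l' ∈ insert l Θ, LForm.rename σ τ l' ∈ insert (LForm.rename σ τ l) Θ' :=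
  (forall_mem_insert _ _ _).2
    ⟨mem_insert_self _ _, fun l' hl' => mem_insert_of_mem (h l' hl')⟩

theorem LForm.rename_congr {σ σ' τ τ' : ℕ → ℕ} {l : LForm}
    (h : ∀ x ∈ l.1.noms ∪ l.2.noms, σ x = σ' x) (h' : ∀ i ∈ l.1.nats, τ i = τ' i) :
    LForm.rename σ τ l = LForm.rename σ' τ' l :=
  Prod.ext (Label.rename_congr (fun x hx => h x (mem_union_left _ hx)) h')
    (Form.applySub_congr fun x hx => h x (mem_union_right _ hx))

/-- Cut-free provability is preserved by renaming followed by weakening. -/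
theorem Deriv.provable_of_rename {T : Finset Label} {Γ Δ : Finset LForm} {h : ℕ}
    (d : Deriv false T Γ Δ h) {σ τ : ℕ → ℕ} {T' : Finset Label} {Γ' Δ' : Finset LForm}
    (hT : ∀ α ∈ T, α.rename σ τ ∈ T') (hΓ : ∀ l ∈ Γ, LForm.rename σ τ l ∈ Γ')
    (hΔ : ∀ l ∈ Δ, LForm.rename σ τ l ∈ Δ') : Provable false T' Γ' Δ' := by
  induction d generalizing σ τ T' Γ' Δ' with
  | bot α n => exact .of_bot_mem (hΓ _ (mem_insert_self _ _))
  | id α n φ => exact .of_mem_of_mem (hΓ _ (mem_insert_self _ _)) (hΔ _ (mem_insert_self _ _))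
  | rep1 α n m k φ _ ih =>
    rw [forall_mem_insert, forall_mem_insert] at hΓ
    obtain ⟨k', hk'⟩ := Infinite.exists_notMem_finset (φ.noms.image σ)
    have h := hΓ.2.1
    rw [LForm.rename, Form.applySub_sub hk'] at h
    refine .rep1 hΓ.1 h (ih hT ?_ hΔ)
    rw [← Form.applySub_sub hk', forall_mem_insert]
    exact ⟨mem_insert_of_mem hΓ.1, LForm.rename_mem_insert hΓ.2.2 _⟩
  | rep2 α n m k φ _ ih =>
    rw [forall_mem_insert, forall_mem_insert] at hΓ
    obtain ⟨k', hk'⟩ := Infinite.exists_notMem_finset (φ.noms.image σ)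
    have h := hΓ.2.1
    rw [LForm.rename, Form.applySub_sub hk'] at h
    refine .rep2 hΓ.1 h (ih hT ?_ hΔ)
    rw [← Form.applySub_sub hk', forall_mem_insert]
    exact ⟨mem_insert_of_mem hΓ.1, LForm.rename_mem_insert hΓ.2.2 _⟩
  | refl α n hα _ ih =>
    exact .refl (n := σ n) (hT α hα) (ih hT (LForm.rename_mem_insert hΓ _) hΔ)
  | rigid α β n m hβ _ ih =>
    rw [forall_mem_insert] at hΓ
    exact .rigid (hT β hβ) hΓ.1 (ih hT (LForm.rename_mem_insert hΓ.2 _) hΔ)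
  | impR α n φ ψ _ ih =>
    rw [forall_mem_insert] at hΔ
    exact .impR hΔ.1
      (ih hT (LForm.rename_mem_insert hΓ _) (LForm.rename_mem_insert hΔ.2 _))
  | impL α n φ ψ _ _ ih₁ ih₂ =>
    rw [forall_mem_insert] at hΓ
    exact .impL hΓ.1 (ih₁ hT hΓ.2 (LForm.rename_mem_insert hΔ _))
      (ih₂ hT (LForm.rename_mem_insert hΓ.2 _) hΔ)
  | atR α n m φ _ ih =>
    rw [forall_mem_insert] at hΔ
    exact .atR hΔ.1 (ih hT hΓ (LForm.rename_mem_insert hΔ.2 _))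
  | atL α n m φ _ ih =>
    rw [forall_mem_insert] at hΓ
    exact .atL hΓ.1 (ih hT (LForm.rename_mem_insert hΓ.2 _) hΔ)
  | @frR T Γ Δ _ α n m φ hm _ ih =>
    obtain ⟨m', hm'⟩ := exists_freshNom T' Γ' Δ'
    have upd : ∀ s : Finset ℕ, m ∉ s → ∀ x ∈ s, σ x = Function.update σ m m' x :=
      fun s hs x hx => (Function.update_of_ne (ne_of_mem_of_not_mem hx hs) _ _).symm
    have hl : ∀ l : LForm, m ∉ l.1.noms ∧ m ∉ l.2.noms →
        LForm.rename σ τ l = LForm.rename (Function.update σ m m') τ l :=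
      fun l hl => LForm.rename_congr (upd _ (by simpa using hl)) fun _ _ => rfl
    replace hT : ∀ α ∈ T, α.rename (Function.update σ m m') τ ∈ T' := fun α hα => by
      rw [← Label.rename_congr (upd _ (hm.1 α hα)) fun _ _ => rfl]
      exact hT α hα
    replace hΓ : ∀ l ∈ Γ, LForm.rename (Function.update σ m m') τ l ∈ Γ' :=
      fun l h => hl l (hm.2.1 l h) ▸ hΓ l h
    replace hΔ : ∀ l ∈ insert (α, Form.atf n (Form.fr φ)) Δ,
        LForm.rename (Function.update σ m m') τ l ∈ Δ' :=
      fun l h => hl l (hm.2.2 l h) ▸ hΔ l h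
    rw [forall_mem_insert] at hΔ
    have key := ih hT (LForm.rename_mem_insert hΓ _) (LForm.rename_mem_insert hΔ.2 _)
    refine .frR (m := m') hΔ.1 hm' ?_
    simpa [LForm.rename, ApplySub, Form.diaF, Form.neg] using key
  | frL α n m φ _ _ ih₁ ih₂ =>
    rw [forall_mem_insert] at hΓ
    exact .frL hΓ.1 (ih₁ hT hΓ.2 (LForm.rename_mem_insert hΔ _))
      (ih₂ hT (LForm.rename_mem_insert hΓ.2 _) hΔ)
  | @boxR T Γ Δ _ α n i φ hi _ ih =>
    obtain ⟨i', hi'⟩ := exists_freshNat T' Γ' Δ'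
    have upd : ∀ s : Finset ℕ, i ∉ s → ∀ x ∈ s, τ x = Function.update τ i i' x :=
      fun s hs x hx => (Function.update_of_ne (ne_of_mem_of_not_mem hx hs) _ _).symm
    have hl : ∀ l : LForm, i ∉ l.1.nats →
        LForm.rename σ τ l = LForm.rename σ (Function.update τ i i') l :=
      fun l hl => LForm.rename_congr (fun _ _ => rfl) (upd _ hl)
    replace hT : ∀ α ∈ T, α.rename σ (Function.update τ i i') ∈ T' := fun α hα => by
      rw [← Label.rename_congr (fun _ _ => rfl) (upd _ (hi.1 α hα))]
      exact hT α hα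
    replace hΓ : ∀ l ∈ Γ, LForm.rename σ (Function.update τ i i') l ∈ Γ' :=
      fun l h => hl l (hi.2.1 l h) ▸ hΓ l h
    replace hΔ : ∀ l ∈ insert (α, Form.atf n (Form.box φ)) Δ,
        LForm.rename σ (Function.update τ i i') l ∈ Δ' :=
      fun l h => hl l (hi.2.2 l h) ▸ hΔ l h
    rw [forall_mem_insert] at hΔ
    have key := ih (T' := insert ((Label.child α n i).rename σ (Function.update τ i i')) T')
      ((forall_mem_insert _ _ _).2
        ⟨mem_insert_self _ _, fun β hβ => mem_insert_of_mem (hT β hβ)⟩)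
      hΓ (LForm.rename_mem_insert hΔ.2 _)
    refine .boxR (i := i') hΔ.1 hi' ?_
    simpa [LForm.rename, Label.rename, ApplySub] using key
  | boxL α n i φ hi _ ih =>
    rw [forall_mem_insert] at hΓ
    exact .boxL (hT _ hi) hΓ.1 (ih hT (LForm.rename_mem_insert hΓ.2 _) hΔ)
  | wlab α _ _ ih => exact ih (fun β hβ => hT β (mem_insert_of_mem hβ)) hΓ hΔ
  | cut _ _ _ hc => exact absurd hc Bool.false_ne_true

theorem Provable.weaken {T T' : Finset Label} {Γ Γ' Δ Δ' : Finset LForm}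
    (hT : T ⊆ T') (hΓ : Γ ⊆ Γ') (hΔ : Δ ⊆ Δ') :
    Provable false T Γ Δ → Provable false T' Γ' Δ' := by
  have hid : ∀ l, LForm.rename id id l = l := fun l =>
    Prod.ext (Label.rename_id _) (Form.applySub_id _)
  rintro ⟨_, d⟩
  exact d.provable_of_rename (σ := id) (τ := id)
    (fun α hα => (Label.rename_id α).symm ▸ hT hα)
    (fun l hl => (hid l).symm ▸ hΓ hl) (fun l hl => (hid l).symm ▸ hΔ hl)

/-! ### Countability of the language -/

/-- A Gödel numbering of formulas. -/
def Form.code : Form → ℕ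
  | .nom n => Nat.pair 0 n
  | .pv p => Nat.pair 1 p
  | .bot => Nat.pair 2 0
  | .imp φ ψ => Nat.pair 3 (Nat.pair φ.code ψ.code)
  | .atf n φ => Nat.pair 4 (Nat.pair n φ.code)
  | .fr φ => Nat.pair 5 φ.code
  | .box φ => Nat.pair 6 φ.code

theorem Form.code_injective : Function.Injective Form.code := by
  intro φ
  induction φ <;> rintro (_ | _ | _ | _ | _ | _ | _) h <;>
    simp_all [Form.code, Nat.pair_eq_pair] <;> grind

instance : Countable Form := Form.code_injective.countable

/-- A Gödel numbering of labels. -/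
def Label.code : Label → ℕ
  | .root j => Nat.pair 0 j
  | .child α n i => Nat.pair 1 (Nat.pair α.code (Nat.pair n i))

theorem Label.code_injective : Function.Injective Label.code := by
  intro α
  induction α <;> rintro (_ | _) h <;> simp_all [Label.code, Nat.pair_eq_pair]
  grind

instance : Countable Label := Label.code_injective.countable

/-! ### Saturation -/

/-- A finite tree sequent that is not provable in the cut-free calculus. -/
structure UnprovableSequent : Type where
  T : Finset Label
  Γ : Finset LForm
  Δ : Finset LForm
  isTree : IsTree T
  left_mem : ∀ l ∈ Γ, l.1 ∈ T
  right_mem : ∀ l ∈ Δ, l.1 ∈ T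
  unprovable : ¬ Provable false T Γ Δ

namespace UnprovableSequent

instance : Preorder UnprovableSequent where
  le s t := s.T ⊆ t.T ∧ s.Γ ⊆ t.Γ ∧ s.Δ ⊆ t.Δ
  le_refl _ := ⟨Subset.rfl, Subset.rfl, Subset.rfl⟩
  le_trans _ _ _ h h' := ⟨h.1.trans h'.1, h.2.1.trans h'.2.1, h.2.2.trans h'.2.2⟩

/-- `l` has been added to the antecedent unless that makes the sequent provable. -/
def DecidesLeft (s : UnprovableSequent) (l : LForm) : Prop :=
  l ∈ s.Γ ∨ Provable false s.T (insert l s.Γ) s.Δ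

/-- `s` contains the premise of the rule (FR) or (□R) with principal formula `l`. -/
def HasWitness (s : UnprovableSequent) (l : LForm) : Prop :=
  (∀ n φ, l.2 = Form.atf n (Form.fr φ) →
    ∃ m, (l.1, Form.atf n (Form.diaF (Form.nom m))) ∈ s.Γ ∧ (l.1, Form.atf m φ) ∈ s.Δ) ∧
  ∀ n φ, l.2 = Form.atf n (Form.box φ) →
    ∃ i, Label.child l.1 n i ∈ s.T ∧ (Label.child l.1 n i, Form.atf n φ) ∈ s.Δ

/-- `l` has been added to the succedent, together with a witness, unless that makes the
sequent provable. -/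
def DecidesRight (s : UnprovableSequent) (l : LForm) : Prop :=
  l ∈ s.Δ ∧ s.HasWitness l ∨ Provable false s.T s.Γ (insert l s.Δ)

variable {s t : UnprovableSequent} {l : LForm}

theorem DecidesLeft.mono (hst : s ≤ t) : s.DecidesLeft l → t.DecidesLeft l :=
  Or.imp (fun h => hst.2.1 h) (Provable.weaken hst.1 (insert_subset_insert _ hst.2.1) hst.2.2)

theorem exists_le_decidesLeft (h : l.1 ∈ s.T) : ∃ t, s ≤ t ∧ t.DecidesLeft l := by
  by_cases hp : Provable false s.T (insert l s.Γ) s.Δ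
  · exact ⟨s, le_rfl, .inr hp⟩
  · exact ⟨⟨s.T, insert l s.Γ, s.Δ, s.isTree, (forall_mem_insert _ _ _).2 ⟨h, s.left_mem⟩,
      s.right_mem, hp⟩, ⟨Subset.rfl, subset_insert _ _, Subset.rfl⟩, .inl (mem_insert_self _ _)⟩

theorem exists_le_hasWitness (h : l ∈ s.Δ) : ∃ t, s ≤ t ∧ t.HasWitness l := by
  obtain ⟨α, χ⟩ := l
  have hα := s.right_mem _ h
  by_cases hF : ∃ n φ, χ = Form.atf n (Form.fr φ)
  · obtain ⟨n, φ, rfl⟩ := hF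
    obtain ⟨m, hm⟩ := exists_freshNom s.T s.Γ s.Δ
    refine ⟨⟨s.T, insert (α, Form.atf n (Form.diaF (Form.nom m))) s.Γ,
      insert (α, Form.atf m φ) s.Δ, s.isTree, (forall_mem_insert _ _ _).2 ⟨hα, s.left_mem⟩,
      (forall_mem_insert _ _ _).2 ⟨hα, s.right_mem⟩, fun hp => s.unprovable (.frR h hm hp)⟩,
      ⟨Subset.rfl, subset_insert _ _, subset_insert _ _⟩, ?_, ?_⟩
    · rintro _ _ ⟨⟩
      exact ⟨m, mem_insert_self _ _, mem_insert_self _ _⟩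
    · rintro _ _ ⟨⟩
  by_cases hB : ∃ n φ, χ = Form.atf n (Form.box φ)
  · obtain ⟨n, φ, rfl⟩ := hB
    obtain ⟨i, hi⟩ := exists_freshNat s.T s.Γ s.Δ
    refine ⟨⟨insert (Label.child α n i) s.T, s.Γ, insert (Label.child α n i, Form.atf n φ) s.Δ,
      ⟨by simpa using s.isTree.1, ?_⟩, fun l hl => mem_insert_of_mem (s.left_mem l hl),
      (forall_mem_insert _ _ _).2
        ⟨mem_insert_self _ _, fun l hl => mem_insert_of_mem (s.right_mem l hl)⟩,
      fun hp => s.unprovable (.boxR h hi hp)⟩,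
      ⟨subset_insert _ _, Subset.rfl, subset_insert _ _⟩, ?_, ?_⟩
    · intro β m j hβ
      rcases mem_insert.1 hβ with hβ | hβ
      · cases hβ
        exact mem_insert_of_mem hα
      · exact mem_insert_of_mem (s.isTree.2 β m j hβ)
    · rintro _ _ ⟨⟩
    · rintro _ _ ⟨⟩
      exact ⟨i, mem_insert_self _ _, mem_insert_self _ _⟩
  · exact ⟨s, le_rfl, fun n φ e => (hF ⟨n, φ, e⟩).elim, fun n φ e => (hB ⟨n, φ, e⟩).elim⟩

theorem exists_le_decidesRight (h : l.1 ∈ s.T) : ∃ t, s ≤ t ∧ t.DecidesRight l := by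
  by_cases hp : Provable false s.T s.Γ (insert l s.Δ)
  · exact ⟨s, le_rfl, .inr hp⟩
  · let t : UnprovableSequent := ⟨s.T, s.Γ, insert l s.Δ, s.isTree, s.left_mem,
      (forall_mem_insert _ _ _).2 ⟨h, s.right_mem⟩, hp⟩
    have hl : l ∈ t.Δ := mem_insert_self _ _
    obtain ⟨u, htu, hu⟩ := exists_le_hasWitness hl
    have hst : s ≤ t := ⟨Subset.rfl, Subset.rfl, subset_insert _ _⟩
    exact ⟨u, hst.trans htu, .inl ⟨htu.2.2 hl, hu⟩⟩

theorem exists_le_decides (h : l.1 ∈ s.T) :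
    ∃ t, s ≤ t ∧ t.DecidesLeft l ∧ t.DecidesRight l := by
  obtain ⟨t, hst, ht⟩ := exists_le_decidesLeft h
  obtain ⟨u, htu, hu⟩ := exists_le_decidesRight (hst.1 h)
  exact ⟨u, hst.trans htu, ht.mono htu, hu⟩

/-- The sequents that decide `l`, or that have no extension whose tree contains its label. -/
def deciding (l : LForm) : Order.Cofinal UnprovableSequent where
  carrier := {s | s.DecidesLeft l ∧ s.DecidesRight l ∨ ∀ t, s ≤ t → l.1 ∉ t.T}
  isCofinal s := by
    by_cases h : ∃ t, s ≤ t ∧ l.1 ∈ t.T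
    · obtain ⟨t, hst, ht⟩ := h
      obtain ⟨u, htu, hu⟩ := exists_le_decides ht
      exact ⟨u, .inl hu, hst.trans htu⟩
    · exact ⟨s, .inr fun t hst ht => h ⟨t, hst, ht⟩, le_rfl⟩

/-- Every unprovable sequent starts an increasing sequence deciding every labelled formula
whose label eventually appears. -/
theorem exists_monotone_decides (s : UnprovableSequent) :
    ∃ S : ℕ → UnprovableSequent, Monotone S ∧ S 0 = s ∧
      ∀ l : LForm, (∃ k, l.1 ∈ (S k).T) → ∃ k, (S k).DecidesLeft l ∧ (S k).DecidesRight l := by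
  have : Encodable LForm := Encodable.ofCountable _
  refine ⟨Order.sequenceOfCofinals s deciding, Order.sequenceOfCofinals.monotone s deciding, rfl,
    fun l ⟨k, hk⟩ => ?_⟩
  refine ⟨_, (Order.sequenceOfCofinals.encode_mem s deciding l).resolve_right fun h => ?_⟩
  have mono := Order.sequenceOfCofinals.monotone s deciding
  exact h _ (mono (le_max_left _ k)) ((mono (le_max_right _ k)).1 hk)

/-- The limit of an increasing sequence of unprovable sequents is unprovable. -/
theorem not_infProvable_limit {S : ℕ → UnprovableSequent} (hS : Monotone S) :
    ¬ InfProvable {α | ∃ k, α ∈ (S k).T} {l | ∃ k, l ∈ (S k).Γ} {l | ∃ k, l ∈ (S k).Δ} := by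
  rintro ⟨T, Γ, Δ, hT, -, hΓ, hΔ, hp⟩
  have eT : ∀ᶠ k in atTop, ∀ α ∈ T, α ∈ (S k).T := (eventually_all_finset _).2 fun α hα =>
    (hT hα).elim fun k hk => (eventually_ge_atTop k).mono fun _ h => (hS h).1 hk
  have eΓ : ∀ᶠ k in atTop, ∀ l ∈ Γ, l ∈ (S k).Γ := (eventually_all_finset _).2 fun l hl =>
    (hΓ hl).elim fun k hk => (eventually_ge_atTop k).mono fun _ h => (hS h).2.1 hk
  have eΔ : ∀ᶠ k in atTop, ∀ l ∈ Δ, l ∈ (S k).Δ := (eventually_all_finset _).2 fun l hl =>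
    (hΔ hl).elim fun k hk => (eventually_ge_atTop k).mono fun _ h => (hS h).2.2 hk
  obtain ⟨k, hT, hΓ, hΔ⟩ := (eT.and (eΓ.and eΔ)).exists
  exact (S k).unprovable (hp.weaken hT hΓ hΔ)

theorem setIsTree_limit {S : ℕ → UnprovableSequent} (hS : Monotone S) :
    SetIsTree {α | ∃ k, α ∈ (S k).T} := by
  obtain ⟨j, hj, -⟩ := (S 0).isTree.1
  refine ⟨⟨j, ⟨0, hj⟩, fun i ⟨k, hi⟩ => ?_⟩,
    fun α n i ⟨k, hk⟩ => ⟨k, (S k).isTree.2 α n i hk⟩⟩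
  exact (S k).isTree.1.unique hi ((hS (Nat.zero_le k)).1 hj)

/-- The limit of an increasing sequence deciding every labelled formula is saturated. -/
theorem saturated_limit {S : ℕ → UnprovableSequent} (hS : Monotone S)
    (hdec : ∀ l : LForm, (∃ k, l.1 ∈ (S k).T) →
      ∃ k, (S k).DecidesLeft l ∧ (S k).DecidesRight l) :
    Saturated {α | ∃ k, α ∈ (S k).T} {l | ∃ k, l ∈ (S k).Γ} {l | ∃ k, l ∈ (S k).Δ} := by
  have evT : ∀ {α}, (∃ k, α ∈ (S k).T) → ∀ᶠ k in atTop, α ∈ (S k).T := fun ⟨k, hk⟩ =>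
    (eventually_ge_atTop k).mono fun _ h => (hS h).1 hk
  have evΓ : ∀ {l}, (∃ k, l ∈ (S k).Γ) → ∀ᶠ k in atTop, l ∈ (S k).Γ := fun ⟨k, hk⟩ =>
    (eventually_ge_atTop k).mono fun _ h => (hS h).2.1 hk
  have evΔ : ∀ {l}, (∃ k, l ∈ (S k).Δ) → ∀ᶠ k in atTop, l ∈ (S k).Δ := fun ⟨k, hk⟩ =>
    (eventually_ge_atTop k).mono fun _ h => (hS h).2.2 hk
  have labelΓ : ∀ {α χ}, (∃ k, (α, χ) ∈ (S k).Γ) → ∃ k, α ∈ (S k).T :=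
    fun ⟨k, hk⟩ => ⟨k, (S k).left_mem _ hk⟩
  have labelΔ : ∀ {α χ}, (∃ k, (α, χ) ∈ (S k).Δ) → ∃ k, α ∈ (S k).T :=
    fun ⟨k, hk⟩ => ⟨k, (S k).right_mem _ hk⟩
  have left : ∀ {α χ}, (∃ k, α ∈ (S k).T) → (¬ ∃ k, (α, χ) ∈ (S k).Γ) →
      ∀ᶠ k in atTop, Provable false (S k).T (insert (α, χ) (S k).Γ) (S k).Δ := by
    intro α χ hα hn
    obtain ⟨k, hk, -⟩ := hdec (α, χ) hα
    filter_upwards [eventually_ge_atTop k] with j hj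
    exact (hk.mono (hS hj)).resolve_left fun h => hn ⟨j, h⟩
  have right : ∀ {α χ}, (∃ k, α ∈ (S k).T) → (¬ ∃ k, (α, χ) ∈ (S k).Δ) →
      ∀ᶠ k in atTop, Provable false (S k).T (S k).Γ (insert (α, χ) (S k).Δ) := by
    intro α χ hα hn
    obtain ⟨k, -, hk⟩ := hdec (α, χ) hα
    filter_upwards [eventually_ge_atTop k] with j hj
    exact (hk.resolve_left fun h => hn ⟨k, h.1⟩).weaken (hS hj).1 (hS hj).2.1
      (insert_subset_insert _ (hS hj).2.2)
  have witness : ∀ {l : LForm}, (∃ k, l ∈ (S k).Δ) → ∃ k, (S k).HasWitness l := by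
    intro l hl
    obtain ⟨k, -, hk⟩ := hdec l (labelΔ hl)
    refine ⟨k, (hk.resolve_right fun hp => ?_).2⟩
    obtain ⟨j, hj, hkj⟩ := ((evΔ hl).and (eventually_ge_atTop k)).exists
    exact (S j).unprovable
      (hp.weaken (hS hkj).1 (hS hkj).2.1 (insert_subset hj (hS hkj).2.2))
  have contra : ¬ ∀ᶠ k in atTop, Provable false (S k).T (S k).Γ (S k).Δ := fun h =>
    h.exists.elim fun k hk => (S k).unprovable hk
  constructor
  · intro α n m k φ h h'
    by_contra hn
    refine contra ?_
    filter_upwards [evΓ h, evΓ h', left (labelΓ h) hn] with j h h' hp using .rep2 h h' hp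
  · intro α n m k φ h h'
    by_contra hn
    refine contra ?_
    filter_upwards [evΓ h, evΓ h', left (labelΓ h) hn] with j h h' hp using .rep1 h h' hp
  · intro α hα n
    by_contra hn
    refine contra ?_
    filter_upwards [evT hα, left hα hn] with j h hp using .refl h hp
  · intro α β n m hβ h
    by_contra hn
    refine contra ?_
    filter_upwards [evT hβ, evΓ h, left hβ hn] with j hβ h hp using .rigid hβ h hp
  · intro α n φ ψ h
    constructor <;> by_contra hn <;> refine contra ?_
    · filter_upwards [evΔ h, left (labelΔ h) hn] with j h hp using
        .impR h (hp.weaken Subset.rfl Subset.rfl (subset_insert _ _))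
    · filter_upwards [evΔ h, right (labelΔ h) hn] with j h hp using
        .impR h (hp.weaken Subset.rfl (subset_insert _ _) Subset.rfl)
  · intro α n φ ψ h
    by_contra! hn
    refine contra ?_
    filter_upwards [evΓ h, right (labelΓ h) hn.1, left (labelΓ h) hn.2] with j h hp hp' using
      .impL h hp hp'
  · intro α n m φ h
    by_contra hn
    refine contra ?_
    filter_upwards [evΔ h, right (labelΔ h) hn] with j h hp using .atR h hp
  · intro α n m φ h
    by_contra hn
    refine contra ?_
    filter_upwards [evΓ h, left (labelΓ h) hn] with j h hp using .atL h hp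
  · intro α n φ h
    obtain ⟨k, hk, -⟩ := witness h
    obtain ⟨m, h₁, h₂⟩ := hk n φ rfl
    exact ⟨m, ⟨k, h₁⟩, ⟨k, h₂⟩⟩
  · intro α n φ h m
    by_contra! hn
    refine contra ?_
    filter_upwards [evΓ h, right (labelΓ h) hn.1, left (labelΓ h) hn.2] with j h hp hp' using
      .frL h hp hp'
  · intro α n φ h
    obtain ⟨k, -, hk⟩ := witness h
    obtain ⟨i, h₁, h₂⟩ := hk n φ rfl
    exact ⟨i, ⟨k, h₁⟩, ⟨k, h₂⟩⟩
  · intro α n φ h i hi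
    by_contra hn
    refine contra ?_
    filter_upwards [evΓ h, evT hi, left hi hn] with j h hi hp using .boxL hi h hp

end UnprovableSequent

/-- Saturation lemma. -/
theorem saturation_lemma (T : Finset Label) (Γ Δ : Finset LForm)
    (hT : IsTree T) (hΓ : ∀ l ∈ Γ, l.1 ∈ T) (hΔ : ∀ l ∈ Δ, l.1 ∈ T)
    (hunp : ¬ Provable false T Γ Δ) :
    ∃ (T' : Set Label) (Γ' Δ' : Set LForm),
      SetIsTree T' ∧ (∀ l ∈ Γ', Prod.fst l ∈ T') ∧ (∀ l ∈ Δ', Prod.fst l ∈ T') ∧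
      Saturated T' Γ' Δ' ∧ ¬ InfProvable T' Γ' Δ' ∧
      ↑T ⊆ T' ∧ ↑Γ ⊆ Γ' ∧ ↑Δ ⊆ Δ' := by
  obtain ⟨S, hS, h0, hdec⟩ :=
    UnprovableSequent.exists_monotone_decides ⟨T, Γ, Δ, hT, hΓ, hΔ, hunp⟩
  exact ⟨{α | ∃ k, α ∈ (S k).T}, {l | ∃ k, l ∈ (S k).Γ}, {l | ∃ k, l ∈ (S k).Δ},
    UnprovableSequent.setIsTree_limit hS,
    fun l ⟨k, hk⟩ => ⟨k, (S k).left_mem l hk⟩, fun l ⟨k, hk⟩ => ⟨k, (S k).right_mem l hk⟩,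
    UnprovableSequent.saturated_limit hS hdec, UnprovableSequent.not_infProvable_limit hS,
    fun α hα => ⟨0, by rw [h0]; exact hα⟩, fun l hl => ⟨0, by rw [h0]; exact hl⟩,
    fun l hl => ⟨0, by rw [h0]; exact hl⟩⟩
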